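/- (Fast-group decodability.) Let A_1, …, A_N ∈ ℂ^{n_t×T} be the weight matrices of a linear STBC. Let 0 = N_0 < N_1 < … < N_g = N define an ordered partition of {1,…,N} into g consecutive groups Γ_t = {N_{t−1}+1,…,N_t}, and within each group Γ_t let a number L_t ≤ |Γ_t| and a sub-assignment c_t of the first L_t indices of Γ_t into sub-groups be given. Suppose that the pair (A_i, A_j) satisfies the symmetrized trace conditions whenever (a) i and j lie in different groups Γ_s ≠ Γ_t, or (b) i and j are both among the first L_t indices of the same group Γ_t and lie in different sub-groups under c_t. Then for every n_r and every H ∈ ℂ^{n_r×n_t}, letting h_k^eq = ṽec(H·A_k) and r_1,…,r_N their (unnormalized) Gram–Schmidt orthogonalization, one has ⟨r_i, h_j^eq⟩ = 0 for every such pair (i,j); i.e. the R-factor of the equivalent channel matrix is block diagonal across groups and, within each group, its leading L_t×L_t block is block diagonal across sub-groups, so the code is fast-group sphere decodable, independently of H and n_r. -/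

import Mathlib

open Matrix Complex
open scoped RealInnerProductSpace ComplexConjugate

instance finWFLT (N : ℕ) : WellFoundedLT (Fin N) := inferInstance

/-- Realified (column-stacked) vectorization of a complex matrix. -/
noncomputable def tvec {m n : ℕ} (X : Matrix (Fin m) (Fin n) ℂ) :
    EuclideanSpace ℝ (Fin n × Fin m × Fin 2) :=
  WithLp.toLp 2 (fun p => if p.2.2 = 0 then (X p.2.1 p.1).re else (X p.2.1 p.1).im)

/-- The symmetrized trace conditions on a pair of complex `n_t × T` matrices. -/
def SymTraceCond {nt T : ℕ} (A B : Matrix (Fin nt) (Fin T) ℂ) : Prop :=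
  (∀ q p : Fin nt, q ≤ p →
    ∑ l : Fin T, (A q l * conj (B p l) + A p l * conj (B q l)).re = 0) ∧
  (∀ q p : Fin nt, q < p →
    ∑ l : Fin T, (Complex.I * (A q l * conj (B p l) - A p l * conj (B q l))).re = 0)

/-- Membership of index `i` in the `t`-th consecutive group determined by the boundaries
`0 = Nb 0 < Nb 1 < … < Nb g = N`: group `Γ_t = {Nb t + 1, …, Nb (t+1)}` (0-based:
`Nb t ≤ i < Nb (t+1)`). -/
def InGrp {N g : ℕ} (Nb : Fin (g + 1) → ℕ) (t : Fin g) (i : Fin N) : Prop :=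
  Nb t.castSucc ≤ (i : ℕ) ∧ (i : ℕ) < Nb t.succ

/-- The pairs `(i,j)` required to be orthogonal for fast-group decodability: either `i`
and `j` lie in different groups, or they lie among the first `L t` positions of the same
group `t` and belong to different sub-groups under the sub-assignment `c t`. -/
def FGPair {N g : ℕ} (Nb : Fin (g + 1) → ℕ) (L : Fin g → ℕ) (c : Fin g → ℕ → ℕ)
    (i j : Fin N) : Prop :=
  ∃ t s : Fin g, InGrp Nb t i ∧ InGrp Nb s j ∧
    (t ≠ s ∨
      (t = s ∧ (i : ℕ) - Nb t.castSucc < L t ∧ (j : ℕ) - Nb s.castSucc < L s ∧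
        c t ((i : ℕ) - Nb t.castSucc) ≠ c s ((j : ℕ) - Nb s.castSucc)))

theorem SymTraceCond.sum_mul_conj_eq {nt T : ℕ} {A B : Matrix (Fin nt) (Fin T) ℂ}
    (h : SymTraceCond A B) (q p : Fin nt) :
    ∑ l, A p l * conj (B q l) = -conj (∑ l, A q l * conj (B p l)) := by
  have re_le : ∀ q p : Fin nt, q ≤ p →
      (∑ l, A p l * conj (B q l)).re = -(∑ l, A q l * conj (B p l)).re := by
    intro q p hqp
    have := h.1 q p hqp
    rw [← Complex.re_sum, Finset.sum_add_distrib, Complex.add_re] at this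
    linarith
  have im_lt : ∀ q p : Fin nt, q < p →
      (∑ l, A p l * conj (B q l)).im = (∑ l, A q l * conj (B p l)).im := by
    intro q p hqp
    have := h.2 q p hqp
    rw [← Complex.re_sum, ← Finset.mul_sum, Finset.sum_sub_distrib, Complex.I_mul_re,
      Complex.sub_im] at this
    linarith
  apply Complex.ext
  · rw [Complex.neg_re, Complex.conj_re]
    rcases le_total q p with hqp | hqp
    · exact re_le q p hqp
    · rw [re_le p q hqp, neg_neg]
  · rw [Complex.neg_im, Complex.conj_im, neg_neg]
    rcases lt_trichotomy q p with hqp | rfl | hqp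
    · exact im_lt q p hqp
    · rfl
    · exact (im_lt p q hqp).symm

theorem inner_tvec {m n : ℕ} (X Y : Matrix (Fin m) (Fin n) ℂ) :
    ⟪tvec X, tvec Y⟫ = (∑ l, ∑ r, X r l * conj (Y r l)).re := by
  simp only [tvec, PiLp.inner_apply, Fintype.sum_prod_type, Fin.sum_univ_two, Complex.re_sum]
  refine Finset.sum_congr rfl fun l _ => Finset.sum_congr rfl fun r _ => ?_
  simp
  ring

theorem SymTraceCond.inner_tvec_mul_eq_zero {nt T nr : ℕ} {A B : Matrix (Fin nt) (Fin T) ℂ}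
    (h : SymTraceCond A B) (H : Matrix (Fin nr) (Fin nt) ℂ) :
    ⟪tvec (H * A), tvec (H * B)⟫ = 0 := by
  have expand : ∑ l, ∑ r, (H * A) r l * conj ((H * B) r l) =
      ∑ r, ∑ q, ∑ p, H r q * conj (H r p) * ∑ l, A q l * conj (B p l) := by
    rw [Finset.sum_comm]
    refine Finset.sum_congr rfl fun r _ => ?_
    simp only [Matrix.mul_apply, map_sum, map_mul, Finset.sum_mul_sum]
    rw [Finset.sum_comm]
    refine Finset.sum_congr rfl fun q _ => ?_
    rw [Finset.sum_comm]
    refine Finset.sum_congr rfl fun p _ => ?_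
    rw [Finset.mul_sum]
    exact Finset.sum_congr rfl fun l _ => by ring
  rw [inner_tvec, expand, Complex.re_sum]
  refine Finset.sum_eq_zero fun r _ => ?_
  have anti : conj (∑ q, ∑ p, H r q * conj (H r p) * ∑ l, A q l * conj (B p l)) =
      -∑ q, ∑ p, H r q * conj (H r p) * ∑ l, A q l * conj (B p l) := by
    conv_rhs => rw [Finset.sum_comm]
    rw [map_sum, ← Finset.sum_neg_distrib]
    refine Finset.sum_congr rfl fun q _ => ?_
    rw [map_sum, ← Finset.sum_neg_distrib]
    refine Finset.sum_congr rfl fun p _ => ?_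
    rw [h.sum_mul_conj_eq q p, map_mul, map_mul, Complex.conj_conj]
    ring
  have := congrArg Complex.re anti
  rw [Complex.conj_re, Complex.neg_re] at this
  linarith

/-- If pairs related by `P` are orthogonal and `P` passes down along unrelated predecessors,
then Gram–Schmidt vectors stay orthogonal to the input vectors related to their index. -/
theorem inner_gramSchmidt_eq_zero_of_rel {E : Type*} [NormedAddCommGroup E]
    [InnerProductSpace ℝ E] {N : ℕ} (f : Fin N → E) (P : Fin N → Fin N → Prop)
    (orth : ∀ i j, P i j → ⟪f i, f j⟫ = 0)
    (down : ∀ i j k, P i j → k < i → P k i ∨ P k j) (i j : Fin N) (hij : P i j) :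
    ⟪InnerProductSpace.gramSchmidt ℝ f i, f j⟫ = 0 := by
  induction i using WellFoundedLT.induction generalizing j with
  | ind i ih =>
    rw [InnerProductSpace.gramSchmidt_def, inner_sub_left, orth i j hij, zero_sub, sum_inner,
      neg_eq_zero]
    refine Finset.sum_eq_zero fun k hk => ?_
    have hk := Finset.mem_Iio.mp hk
    rw [Submodule.starProjection_singleton, real_inner_smul_left]
    rcases down i j k hij hk with hP | hP
    · simp [ih k hk i hP]
    · simp [ih k hk j hP]

theorem exists_inGrp {N g : ℕ} {Nb : Fin (g + 1) → ℕ} (hNb0 : Nb 0 = 0) (i : Fin N)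
    (m : Fin (g + 1)) (hi : (i : ℕ) < Nb m) : ∃ t : Fin g, InGrp Nb t i := by
  induction m using Fin.induction with
  | zero => omega
  | succ t ih =>
    by_cases ht : (i : ℕ) < Nb t.castSucc
    · exact ih ht
    · exact ⟨t, not_lt.mp ht, hi⟩

theorem FGPair.of_lt {N g : ℕ} {Nb : Fin (g + 1) → ℕ} (hNb0 : Nb 0 = 0)
    {L : Fin g → ℕ} {c : Fin g → ℕ → ℕ} {i j k : Fin N} (hij : FGPair Nb L c i j) (hk : k < i) :
    FGPair Nb L c k i ∨ FGPair Nb L c k j := by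
  have hki : (k : ℕ) < i := hk
  obtain ⟨t, s, hi, hj, hts⟩ := hij
  obtain ⟨u, hu⟩ := exists_inGrp hNb0 k t.succ (hki.trans hi.2)
  by_cases hut : u = t
  · subst hut
    rcases hts with hne | ⟨rfl, hLi, hLj, hc⟩
    · exact Or.inr ⟨u, s, hu, hj, Or.inl hne⟩
    · have hLk : (k : ℕ) - Nb u.castSucc < L u := by omega
      by_cases hck : c u ((k : ℕ) - Nb u.castSucc) = c u ((i : ℕ) - Nb u.castSucc)
      · exact Or.inr ⟨u, u, hu, hj, Or.inr ⟨rfl, hLk, hLj, hck ▸ hc⟩⟩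
      · exact Or.inl ⟨u, u, hu, hi, Or.inr ⟨rfl, hLk, hLi, hck⟩⟩
  · exact Or.inl ⟨u, t, hu, hi, Or.inl hut⟩

/-- fast-group decodability: given an ordered partition of the `N` weight
matrices into `g` consecutive groups with boundaries `Nb`, sub-block sizes `L t` and
sub-assignments `c t`, if the symmetrized trace conditions hold for every pair `(i,j)`
that lies in different groups, or among the first `L t` indices of a common group `t` in
different sub-groups, then for every `n_r` and `H` the Gram–Schmidt vectors of the columns
`h_k^eq = ṽec(H·A_k)` satisfy `⟨r_i, h_j^eq⟩ = 0` for every such pair: the `R`-factor is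
block diagonal across groups and its leading `L_t×L_t` block within each group is block
diagonal across sub-groups, independently of `H` and `n_r`. -/
theorem stmt15 (nt T N g : ℕ)
    (A : Fin N → Matrix (Fin nt) (Fin T) ℂ)
    (Nb : Fin (g + 1) → ℕ) (hNb0 : Nb 0 = 0) (hNbN : Nb (Fin.last g) = N)
    (hmono : StrictMono Nb)
    (L : Fin g → ℕ) (hL : ∀ t : Fin g, L t ≤ Nb t.succ - Nb t.castSucc)
    (c : Fin g → ℕ → ℕ)
    (h : ∀ i j : Fin N, FGPair Nb L c i j → SymTraceCond (A i) (A j)) :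
    ∀ (nr : ℕ) (H : Matrix (Fin nr) (Fin nt) ℂ) (i j : Fin N), FGPair Nb L c i j →
      ⟪InnerProductSpace.gramSchmidt ℝ (fun k => tvec (H * A k)) i, tvec (H * A j)⟫ = 0 := by
  intro nr H
  exact inner_gramSchmidt_eq_zero_of_rel _ (FGPair Nb L c)
    (fun i j hij => (h i j hij).inner_tvec_mul_eq_zero H)
    (fun _ _ _ hij hk => hij.of_lt hNb0 hk)
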